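/- arXiv:math/0505462 — 2 statements merged into one kernel-verified Lean document; each statement's English description precedes it below -/
import Mathlib

section
/- For R = 2, the configuration space M_n(2) consists of exactly one point, namely the configuration with C = (0,0) and J_k = (cos(2(k−1)π/n), sin(2(k−1)π/n)) for k = 1,…,n (all arms stretched out toward the origin). -/
/-- Euclidean norm of a vector in ℝ². -/
noncomputable def enorm2 (v : ℝ × ℝ) : ℝ := Real.sqrt (v.1 ^ 2 + v.2 ^ 2)

/-- The k-th fixed endpoint `B_k = (R cos(2kπ/n), R sin(2kπ/n))` (indices from 0). -/
noncomputable def Bpt (n : ℕ) (R : ℝ) (k : Fin n) : ℝ × ℝ :=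
  (R * Real.cos (2 * (k.val : ℝ) * Real.pi / (n : ℝ)),
   R * Real.sin (2 * (k.val : ℝ) * Real.pi / (n : ℝ)))

/-- The configuration space `M_n(R)` of spiders with `n` arms of radius `R`,
as a subset of `(ℝ²)^{n+1} ≅ ℝ^{2n+2}`: a pair `(C, J)` with
`|C − J_k| = 1` and `|J_k − B_k| = 1` for all `k`. -/
noncomputable def MSpace (n : ℕ) (R : ℝ) : Set ((ℝ × ℝ) × (Fin n → ℝ × ℝ)) :=
  {x | ∀ k : Fin n, enorm2 (x.1 - x.2 k) = 1 ∧ enorm2 (x.2 k - Bpt n R k) = 1}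

/-- `d_n`, the maximum distance between `n`-th roots of unity. -/
noncomputable def dmax (n : ℕ) : ℝ :=
  if Even n then 2
  else Real.sqrt (2 - 2 * Real.cos (2 * ((n / 2 : ℕ) : ℝ) * Real.pi / (n : ℝ)))

/-- The critical radius `R_n = 2 / d_n`. -/
noncomputable def Rcrit (n : ℕ) : ℝ := 2 / dmax n

theorem stmt7_sums (n : ℕ) (hn : 2 ≤ n) :
    ∑ k : Fin n, Real.cos (2 * (k.val : ℝ) * Real.pi / (n : ℝ)) = 0 ∧
    ∑ k : Fin n, Real.sin (2 * (k.val : ℝ) * Real.pi / (n : ℝ)) = 0 := by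
  have h := (Complex.isPrimitiveRoot_exp n (by omega)).geom_sum_eq_zero (by omega)
  rw [Finset.sum_range] at h
  have h2 : ∀ k : Fin n, Complex.exp (2 * Real.pi * Complex.I / n) ^ k.val =
      Complex.exp (((2 * (k.val : ℝ) * Real.pi / (n : ℝ) : ℝ) : ℂ) * Complex.I) := by
    intro k
    rw [← Complex.exp_nat_mul]
    congr 1
    push_cast
    ring
  simp only [h2] at h
  constructor
  · have := congrArg Complex.re h
    simpa only [Complex.re_sum, Complex.exp_ofReal_mul_I_re, Complex.zero_re] using this
  · have := congrArg Complex.im h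
    simpa only [Complex.im_sum, Complex.exp_ofReal_mul_I_im, Complex.zero_im] using this

theorem stmt7_enorm2 (v : ℝ × ℝ) : enorm2 v = 1 ↔ v.1 ^ 2 + v.2 ^ 2 = 1 := by
  unfold enorm2
  exact Real.sqrt_eq_one

/-- `M_n(2)` consists of exactly one point: the configuration with `C = (0,0)` and
`J_k = (cos(2kπ/n), sin(2kπ/n))` (all arms stretched out toward the origin). -/
theorem stmt7 (n : ℕ) (hn : 2 ≤ n) :
    MSpace n 2 =
      {(((0 : ℝ), (0 : ℝ)), fun k : Fin n =>
        (Real.cos (2 * (k.val : ℝ) * Real.pi / (n : ℝ)),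
         Real.sin (2 * (k.val : ℝ) * Real.pi / (n : ℝ))))} := by
  obtain ⟨hc, hs⟩ := stmt7_sums n hn
  ext ⟨⟨a, b⟩, J⟩
  simp only [MSpace, Set.mem_ofPred_eq, stmt7_enorm2, Bpt, Prod.fst_sub, Prod.snd_sub,
    Set.mem_singleton_iff, Prod.mk.injEq]
  have hcs : ∀ k : Fin n, Real.cos (2 * (k.val : ℝ) * Real.pi / (n : ℝ)) ^ 2 +
      Real.sin (2 * (k.val : ℝ) * Real.pi / (n : ℝ)) ^ 2 = 1 :=
    fun k => Real.cos_sq_add_sin_sq _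
  generalize hf : (fun k : Fin n => Real.cos (2 * (k.val : ℝ) * Real.pi / (n : ℝ))) = f at hc
  generalize hg : (fun k : Fin n => Real.sin (2 * (k.val : ℝ) * Real.pi / (n : ℝ))) = g at hs
  have hf' : ∀ k : Fin n, Real.cos (2 * (k.val : ℝ) * Real.pi / (n : ℝ)) = f k :=
    fun k => congrFun hf k
  have hg' : ∀ k : Fin n, Real.sin (2 * (k.val : ℝ) * Real.pi / (n : ℝ)) = g k :=
    fun k => congrFun hg k
  simp only [hf', hg'] at hcs ⊢
  constructor
  · intro h
    have key : ∀ k : Fin n, a ^ 2 + b ^ 2 ≤ 4 * a * f k + 4 * b * g k := by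
      intro k
      obtain ⟨h1, h2⟩ := h k
      nlinarith [hcs k, sq_nonneg ((a - (J k).1) - ((J k).1 - 2 * f k)),
        sq_nonneg ((b - (J k).2) - ((J k).2 - 2 * g k))]
    have hsum := Finset.sum_le_sum (fun k (_ : k ∈ Finset.univ) => key k)
    rw [Finset.sum_add_distrib, Finset.sum_add_distrib, ← Finset.mul_sum, ← Finset.mul_sum, hc, hs] at hsum
    simp only [Finset.sum_const, Finset.card_univ, Fintype.card_fin, nsmul_eq_mul] at hsum
    have hn' : (2 : ℝ) ≤ n := by exact_mod_cast hn
    have hab : a ^ 2 + b ^ 2 ≤ 0 := by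
      by_contra hcon
      push Not at hcon
      nlinarith
    have ha : a = 0 := by nlinarith [sq_nonneg a, sq_nonneg b]
    have hb : b = 0 := by nlinarith [sq_nonneg a, sq_nonneg b]
    refine ⟨⟨ha, hb⟩, ?_⟩
    subst ha hb
    funext k
    obtain ⟨h1, h2⟩ := h k
    have e : ((J k).1 - f k) ^ 2 + ((J k).2 - g k) ^ 2 = 0 := by
      linarith [hcs k]
    have e1 : (J k).1 - f k = 0 := by
      nlinarith [sq_nonneg ((J k).1 - f k), sq_nonneg ((J k).2 - g k)]
    have e2 : (J k).2 - g k = 0 := by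
      nlinarith [sq_nonneg ((J k).1 - f k), sq_nonneg ((J k).2 - g k)]
    exact Prod.ext (by simpa using sub_eq_zero.mp e1) (by simpa using sub_eq_zero.mp e2)
  · rintro ⟨⟨rfl, rfl⟩, rfl⟩ k
    constructor <;> simp only <;> linarith [hcs k]
end

section
/- Suppose 0 < R < 2, R ≠ R_n, and x = (C, J_1, …, J_n) ∈ M_n(R) = F⁻¹(0). Let w ∈ ℝ^{2n+2} be the vector whose entry in the coordinate corresponding to the second coordinate of C is 1 and all other entries are 0 (the gradient of the height function ψ(x) = (second coordinate of C)). Then w lies in the real linear span of the gradients ∇f_1(x), …, ∇f_{2n}(x) if and only if one of the following holds: (i) there exists k such that a_k = b_k and a_{k+1} = b_{k+1} (two adjacent arms stretched out); (ii) there exists k such that C = B_k and the first coordinate of b_k = J_k − B_k is 0 (a folded arm parallel to the y-axis); (iii) there exists k such that a_k = b_k = (0,1) or a_k = b_k = (0,−1) (a stretched-out arm parallel to the y-axis). -/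
/-- The gradient of `f_{2k−1}(x) = |C − J_k|² − 1` at `x`: the vector with `2 a_k`
in the `C` slot and `−2 a_k` in the `J_k` slot (and `0` elsewhere), where
`a_k = C − J_k`. -/
noncomputable def grad1 (n : ℕ) (x : (ℝ × ℝ) × (Fin n → ℝ × ℝ)) (k : Fin n) :
    (ℝ × ℝ) × (Fin n → ℝ × ℝ) :=
  ((2 : ℝ) • (x.1 - x.2 k),
   fun j => if j = k then -((2 : ℝ) • (x.1 - x.2 k)) else 0)

/-- The gradient of `f_{2k}(x) = |J_k − B_k|² − 1` at `x`: the vector with `2 b_k`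
in the `J_k` slot (and `0` elsewhere), where `b_k = J_k − B_k`. -/
noncomputable def grad2 (n : ℕ) (R : ℝ) (x : (ℝ × ℝ) × (Fin n → ℝ × ℝ)) (k : Fin n) :
    (ℝ × ℝ) × (Fin n → ℝ × ℝ) :=
  ((0 : ℝ × ℝ),
   fun j => if j = k then (2 : ℝ) • (x.2 k - Bpt n R k) else 0)


lemma sp_shift (n : ℕ) (hn : 2 ≤ n) (k : Fin n) (t : ℕ) : ∃ i : Fin n,
    Real.cos (2 * (i.val : ℝ) * Real.pi / (n : ℝ))
      = Real.cos (2 * (k.val : ℝ) * Real.pi / n + 2 * (t : ℝ) * Real.pi / n) ∧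
    Real.sin (2 * (i.val : ℝ) * Real.pi / (n : ℝ))
      = Real.sin (2 * (k.val : ℝ) * Real.pi / n + 2 * (t : ℝ) * Real.pi / n) := by
  have hn0 : (n : ℝ) ≠ 0 := by positivity
  refine ⟨⟨(k.val + t) % n, Nat.mod_lt _ (by omega)⟩, ?_⟩
  have h : (((k.val + t) % n : ℕ) : ℝ) = (k.val : ℝ) + t - n * (((k.val + t) / n : ℕ) : ℝ) := by
    have := Nat.mod_add_div (k.val + t) n
    have h2 : (((k.val + t) % n : ℕ) : ℝ) + n * (((k.val + t) / n : ℕ) : ℝ) = k.val + t := by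
      exact_mod_cast this
    linarith
  have e : 2 * (((k.val + t) % n : ℕ) : ℝ) * Real.pi / (n : ℝ)
      = (2 * (k.val : ℝ) * Real.pi / n + 2 * (t : ℝ) * Real.pi / n)
        - (((k.val + t) / n : ℕ) : ℝ) * (2 * Real.pi) := by
    rw [h]; field_simp
  simp only [e]
  exact ⟨Real.cos_sub_nat_mul_two_pi _ _, Real.sin_sub_nat_mul_two_pi _ _⟩

lemma sp_cos_refl (n : ℕ) (hn : 2 ≤ n) (l : ℕ) (hl : l ≤ n) :
    Real.cos (2 * ((n - l : ℕ) : ℝ) * Real.pi / n) = Real.cos (2 * (l : ℝ) * Real.pi / n) := by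
  have hn0 : (n : ℝ) ≠ 0 := by positivity
  rw [← Real.cos_two_pi_sub]
  congr 1
  rw [Nat.cast_sub hl]; field_simp; ring

lemma sp_ang_lt (n : ℕ) (hn : 2 ≤ n) (a b : ℕ) (hab : a < b) (hb : 2 * b ≤ n) :
    Real.cos (2 * (b : ℝ) * Real.pi / n) < Real.cos (2 * (a : ℝ) * Real.pi / n) := by
  have hn0 : (0 : ℝ) < n := by positivity
  have hb' : (2 * b : ℝ) ≤ n := by exact_mod_cast hb
  have hab' : (a : ℝ) < b := by exact_mod_cast hab
  apply Real.cos_lt_cos_of_nonneg_of_le_pi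
  · positivity
  · rw [div_le_iff₀ hn0]; nlinarith [Real.pi_pos]
  · apply div_lt_div_of_pos_right _ hn0
    nlinarith [Real.pi_pos]

lemma sp_ang_lt' (n : ℕ) (hn : 2 ≤ n) (m : ℕ) (h2 : 2 ≤ m) (hm : m + 2 ≤ n) :
    Real.cos (2 * (m : ℝ) * Real.pi / n) < Real.cos (2 * Real.pi / n) := by
  have e : Real.cos (2 * Real.pi / n) = Real.cos (2 * ((1 : ℕ) : ℝ) * Real.pi / n) := by simp
  rw [e]
  rcases le_total (2 * m) n with h | h
  · exact sp_ang_lt n hn 1 m (by omega) h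
  · rw [← sp_cos_refl n hn m (by omega)]
    exact sp_ang_lt n hn 1 (n - m) (by omega) (by omega)

lemma sp_ang_max (n : ℕ) (hn : 2 ≤ n) (l : ℕ) (hl : l < n) :
    Real.cos (2 * ((n / 2 : ℕ) : ℝ) * Real.pi / n) ≤ Real.cos (2 * (l : ℝ) * Real.pi / n) := by
  have key : ∀ l : ℕ, l ≤ n / 2 →
      Real.cos (2 * ((n / 2 : ℕ) : ℝ) * Real.pi / n) ≤ Real.cos (2 * (l : ℝ) * Real.pi / n) := by
    intro l h
    rcases h.lt_or_eq with h | h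
    · exact (sp_ang_lt n hn _ _ h (by omega)).le
    · rw [h]
  rcases le_or_gt l (n / 2) with h | h
  · exact key l h
  · rw [← sp_cos_refl n hn l hl.le]
    exact key _ (by omega)

lemma sp_diff (n : ℕ) (j k : Fin n) (h : j.val ≤ k.val) :
    Real.cos (2 * ((k.val - j.val : ℕ) : ℝ) * Real.pi / n)
     = Real.cos (2 * (k.val : ℝ) * Real.pi / n) * Real.cos (2 * (j.val : ℝ) * Real.pi / n)
      + Real.sin (2 * (k.val : ℝ) * Real.pi / n) * Real.sin (2 * (j.val : ℝ) * Real.pi / n) := by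
  rw [← Real.cos_sub, Nat.cast_sub h]
  congr 1; ring

/-- distinct indices give inner product of directions below one -/
lemma sp_ne (n : ℕ) (hn : 2 ≤ n) (j k : Fin n) (h : j ≠ k) :
     Real.cos (2 * (k.val : ℝ) * Real.pi / n) * Real.cos (2 * (j.val : ℝ) * Real.pi / n)
      + Real.sin (2 * (k.val : ℝ) * Real.pi / n) * Real.sin (2 * (j.val : ℝ) * Real.pi / n) < 1 := by
  have key : ∀ l : ℕ, 0 < l → l < n → Real.cos (2 * (l : ℝ) * Real.pi / n) < 1 := by
    intro l h0 h1
    have e : (1 : ℝ) = Real.cos (2 * ((0 : ℕ) : ℝ) * Real.pi / n) := by simp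
    rw [e]
    rcases le_total (2 * l) n with h | h
    · exact sp_ang_lt n hn 0 l h0 h
    · rw [← sp_cos_refl n hn l (by omega)]
      exact sp_ang_lt n hn 0 (n - l) (by omega) (by omega)
  have hne : j.val ≠ k.val := fun e => h (Fin.ext e)
  rcases lt_or_gt_of_ne hne with h1 | h1
  · rw [← sp_diff n j k h1.le]; exact key _ (by omega) (by omega)
  · have := key (j.val - k.val) (by omega) (by omega)
    rw [sp_diff n k j h1.le] at this; linarith

lemma sp_adj_cos (n : ℕ) (hn : 2 ≤ n) (j k : Fin n) (h : j ≠ k)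
    (hc : Real.cos (2 * Real.pi / n) ≤
      Real.cos (2 * (k.val : ℝ) * Real.pi / n) * Real.cos (2 * (j.val : ℝ) * Real.pi / n)
      + Real.sin (2 * (k.val : ℝ) * Real.pi / n) * Real.sin (2 * (j.val : ℝ) * Real.pi / n)) :
    k.val = (j.val + 1) % n ∨ j.val = (k.val + 1) % n := by
  have main : ∀ j k : Fin n, j.val < k.val → Real.cos (2 * Real.pi / n) ≤
      Real.cos (2 * (k.val : ℝ) * Real.pi / n) * Real.cos (2 * (j.val : ℝ) * Real.pi / n)
      + Real.sin (2 * (k.val : ℝ) * Real.pi / n) * Real.sin (2 * (j.val : ℝ) * Real.pi / n) →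
      k.val = (j.val + 1) % n ∨ j.val = (k.val + 1) % n := by
    intro j k hjk hc
    rw [← sp_diff n j k hjk.le] at hc
    by_cases h1 : k.val - j.val = 1
    · left; rw [Nat.mod_eq_of_lt (by omega)]; omega
    by_cases h2 : k.val - j.val = n - 1
    · right
      have : k.val + 1 = n := by omega
      rw [this, Nat.mod_self]; omega
    exact absurd hc (not_le.mpr (sp_ang_lt' n hn _ (by omega) (by omega)))
  have hne : j.val ≠ k.val := fun e => h (Fin.ext e)
  rcases lt_or_gt_of_ne hne with h1 | h1
  · exact main j k h1 hc
  · exact (main k j h1 (by linarith)).symm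

/-- two minimisers of a linear functional are adjacent -/
lemma sp_adj (n : ℕ) (hn : 2 ≤ n) (p q : ℝ) (hpq : 0 < p ^ 2 + q ^ 2) (j k : Fin n) (hjk : j ≠ k)
    (hmin : ∀ i : Fin n,
      p * Real.cos (2 * (j.val : ℝ) * Real.pi / n) + q * Real.sin (2 * (j.val : ℝ) * Real.pi / n) ≤
      p * Real.cos (2 * (i.val : ℝ) * Real.pi / n) + q * Real.sin (2 * (i.val : ℝ) * Real.pi / n))
    (heq : p * Real.cos (2 * (j.val : ℝ) * Real.pi / n) + q * Real.sin (2 * (j.val : ℝ) * Real.pi / n) =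
      p * Real.cos (2 * (k.val : ℝ) * Real.pi / n) + q * Real.sin (2 * (k.val : ℝ) * Real.pi / n)) :
    k.val = (j.val + 1) % n ∨ j.val = (k.val + 1) % n := by
  apply sp_adj_cos n hn j k hjk
  have hne := sp_ne n hn j k hjk
  have hn0 : (0 : ℝ) < n := by positivity
  obtain ⟨i1, c1, s1⟩ := sp_shift n hn j 1
  obtain ⟨i2, c2, s2⟩ := sp_shift n hn j (n - 1)
  have m1 := hmin i1
  have m2 := hmin i2
  have e2 : 2 * (j.val : ℝ) * Real.pi / n + 2 * ((n - 1 : ℕ) : ℝ) * Real.pi / n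
      = (2 * (j.val : ℝ) * Real.pi / n - 2 * (Real.pi / n)) + 2 * Real.pi := by
    rw [Nat.cast_sub (by omega)]; field_simp; push_cast; ring
  have e1 : 2 * ((1 : ℕ) : ℝ) * Real.pi / n = 2 * (Real.pi / n) := by push_cast; ring
  rw [e2, Real.cos_add_two_pi, Real.cos_sub] at c2
  rw [e2, Real.sin_add_two_pi, Real.sin_sub] at s2
  rw [e1, Real.cos_add] at c1
  rw [e1, Real.sin_add] at s1
  rw [c1, s1] at m1
  rw [c2, s2] at m2
  have e3 : 2 * Real.pi / n = 2 * (Real.pi / n) := by ring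
  rw [e3]
  have hs : 0 < Real.sin (Real.pi / n) := by
    apply Real.sin_pos_of_pos_of_lt_pi (by positivity)
    rw [div_lt_iff₀ hn0]
    have : (2 : ℝ) ≤ n := by exact_mod_cast hn
    nlinarith [Real.pi_pos]
  rw [Real.sin_two_mul, Real.cos_two_mul] at m1 m2
  rw [Real.cos_two_mul]
  have hh := Real.sin_sq_add_cos_sq (Real.pi / n)
  have hj := Real.sin_sq_add_cos_sq (2 * (j.val : ℝ) * Real.pi / n)
  have hk := Real.sin_sq_add_cos_sq (2 * (k.val : ℝ) * Real.pi / n)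
  clear c1 s1 c2 s2 e1 e2 e3 hmin
  generalize Real.sin (Real.pi / n) = S at *
  generalize Real.cos (Real.pi / n) = K at *
  generalize Real.sin (2 * (j.val : ℝ) * Real.pi / n) = sj at *
  generalize Real.cos (2 * (j.val : ℝ) * Real.pi / n) = cj at *
  generalize Real.sin (2 * (k.val : ℝ) * Real.pi / n) = sk at *
  generalize Real.cos (2 * (k.val : ℝ) * Real.pi / n) = ck at *
  obtain ⟨g, hg⟩ : ∃ g, g = p * cj + q * sj := ⟨_, rfl⟩
  obtain ⟨s, hs'⟩ : ∃ s, s = q * cj - p * sj := ⟨_, rfl⟩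
  obtain ⟨t, ht⟩ : ∃ t, t = q * ck - p * sk := ⟨_, rfl⟩
  have hK : K ^ 2 = 1 - S ^ 2 := by linarith
  have n1 : 0 ≤ S * (s * K - g * S) := by
    rw [hK] at m1; rw [hg, hs']; linarith
  have n2 : 0 ≤ S * (-s * K - g * S) := by
    rw [hK] at m2; rw [hg, hs']; linarith
  have n1' := nonneg_of_mul_nonneg_right n1 hs
  have n2' := nonneg_of_mul_nonneg_right n2 hs
  have n3 : 0 ≤ (s * K - g * S) * (-s * K - g * S) := mul_nonneg n1' n2'
  have r1 : g ^ 2 + s ^ 2 = p ^ 2 + q ^ 2 := by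
    rw [hg, hs']; linear_combination (p ^ 2 + q ^ 2) * hj
  have r2 : g ^ 2 + t ^ 2 = p ^ 2 + q ^ 2 := by
    rw [hg, heq, ht]; linear_combination (p ^ 2 + q ^ 2) * hk
  have dot : (p ^ 2 + q ^ 2) * (ck * cj + sk * sj) = g ^ 2 + s * t := by
    have : g ^ 2 = (p * cj + q * sj) * (p * ck + q * sk) := by
      rw [← heq, hg]; ring
    rw [this, hs', ht]; ring
  have hst : t = s ∨ t = -s := by
    apply sq_eq_sq_iff_eq_or_eq_neg.mp; linarith
  rcases hst with h | h
  · exfalso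
    rw [h] at dot
    nlinarith
  · rw [h] at dot
    have : (p ^ 2 + q ^ 2) * (2 * K ^ 2 - 1) ≤ (p ^ 2 + q ^ 2) * (ck * cj + sk * sj) := by
      rw [dot, ← r1]
      nlinarith
    exact le_of_mul_le_mul_left this hpq

lemma sp_dmax (n : ℕ) (hn : 2 ≤ n) :
    dmax n = Real.sqrt (2 - 2 * Real.cos (2 * ((n / 2 : ℕ) : ℝ) * Real.pi / (n : ℝ))) := by
  unfold dmax
  split_ifs with h
  · obtain ⟨m, rfl⟩ := h
    have hm : (m : ℝ) ≠ 0 := by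
      have : m ≠ 0 := by omega
      exact_mod_cast this
    have e : 2 * (((m + m) / 2 : ℕ) : ℝ) * Real.pi / ((m + m : ℕ) : ℝ) = Real.pi := by
      rw [show (m + m) / 2 = m by omega]; push_cast; field_simp; ring
    rw [e, Real.cos_pi]
    rw [show (2 - 2 * (-1) : ℝ) = 2 ^ 2 by norm_num, Real.sqrt_sq (by norm_num)]
  · rfl

/-- a point at extremal distance 2 forces the critical radius -/
lemma sp_crit (n : ℕ) (hn : 2 ≤ n) (R : ℝ) (hR0 : 0 < R) (j k : Fin n)
    (hall : ∀ i : Fin n, ((Bpt n R k).1 - (Bpt n R i).1) ^ 2 + ((Bpt n R k).2 - (Bpt n R i).2) ^ 2 ≤ 4)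
    (hj : ((Bpt n R k).1 - (Bpt n R j).1) ^ 2 + ((Bpt n R k).2 - (Bpt n R j).2) ^ 2 = 4) :
    R = Rcrit n := by
  have dist : ∀ i : Fin n, ((Bpt n R k).1 - (Bpt n R i).1) ^ 2 + ((Bpt n R k).2 - (Bpt n R i).2) ^ 2
      = R ^ 2 * (2 - 2 * (Real.cos (2 * (k.val : ℝ) * Real.pi / n) * Real.cos (2 * (i.val : ℝ) * Real.pi / n)
      + Real.sin (2 * (k.val : ℝ) * Real.pi / n) * Real.sin (2 * (i.val : ℝ) * Real.pi / n))) := by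
    intro i
    simp only [Bpt]
    have h1 := Real.sin_sq_add_cos_sq (2 * (k.val : ℝ) * Real.pi / n)
    have h2 := Real.sin_sq_add_cos_sq (2 * (i.val : ℝ) * Real.pi / n)
    linear_combination R ^ 2 * h1 + R ^ 2 * h2
  have ub : Real.cos (2 * ((n / 2 : ℕ) : ℝ) * Real.pi / n) ≤
      Real.cos (2 * (k.val : ℝ) * Real.pi / n) * Real.cos (2 * (j.val : ℝ) * Real.pi / n)
      + Real.sin (2 * (k.val : ℝ) * Real.pi / n) * Real.sin (2 * (j.val : ℝ) * Real.pi / n) := by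
    rcases le_total j.val k.val with h | h
    · rw [← sp_diff n j k h]; exact sp_ang_max n hn _ (by omega)
    · have := sp_ang_max n hn (j.val - k.val) (by omega)
      rw [sp_diff n k j h] at this; linarith
  obtain ⟨i, ci, si⟩ := sp_shift n hn k (n / 2)
  have hi := hall i
  rw [dist i, ci, si, ← Real.cos_sub] at hi
  rw [dist j] at hj
  have e : 2 * (k.val : ℝ) * Real.pi / n - (2 * (k.val : ℝ) * Real.pi / n + 2 * ((n / 2 : ℕ) : ℝ) * Real.pi / n)
      = -(2 * ((n / 2 : ℕ) : ℝ) * Real.pi / n) := by ring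
  rw [e, Real.cos_neg] at hi
  have hR : 0 < R ^ 2 := by positivity
  have eq : R ^ 2 * (2 - 2 * Real.cos (2 * ((n / 2 : ℕ) : ℝ) * Real.pi / n)) = 4 := by
    apply le_antisymm hi
    rw [← hj]
    apply mul_le_mul_of_nonneg_left _ hR.le
    linarith
  have h2 : R * dmax n = 2 := by
    rw [sp_dmax n hn]
    have : Real.sqrt (R ^ 2 * (2 - 2 * Real.cos (2 * ((n / 2 : ℕ) : ℝ) * Real.pi / n))) = 2 := by
      rw [eq, show (4 : ℝ) = 2 ^ 2 by norm_num, Real.sqrt_sq (by norm_num)]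
    rwa [Real.sqrt_mul hR.le, Real.sqrt_sq hR0.le] at this
  have h0 : dmax n ≠ 0 := by
    intro h; rw [h] at h2; norm_num at h2
  unfold Rcrit
  rw [eq_div_iff h0, h2]

lemma sp_B_inj (n : ℕ) (hn : 2 ≤ n) (R : ℝ) (hR0 : 0 < R) (j k : Fin n)
    (h : Bpt n R j = Bpt n R k) : j = k := by
  by_contra hne
  have hlt := sp_ne n hn j k hne
  simp only [Bpt, Prod.mk.injEq] at h
  have h1 := mul_left_cancel₀ hR0.ne' h.1
  have h2 := mul_left_cancel₀ hR0.ne' h.2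
  rw [h1, h2] at hlt
  nlinarith [Real.sin_sq_add_cos_sq (2 * (k.val : ℝ) * Real.pi / n)]

lemma sp_enorm (v : ℝ × ℝ) (h : enorm2 v = 1) : v.1 ^ 2 + v.2 ^ 2 = 1 := by
  unfold enorm2 at h
  exact Real.sqrt_eq_one.mp h

/-- parallel unit vectors -/
lemma sp_par (a b : ℝ × ℝ) (ha : a.1 ^ 2 + a.2 ^ 2 = 1) (hb : b.1 ^ 2 + b.2 ^ 2 = 1)
    (hd : a.1 * b.2 - a.2 * b.1 = 0) : a = b ∨ a = -b := by
  have h : (a.1 * b.1 + a.2 * b.2) ^ 2 = 1 := by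
    linear_combination (b.1 ^ 2 + b.2 ^ 2) * ha + hb - (a.1 * b.2 - a.2 * b.1) * hd
  rcases sq_eq_sq_iff_eq_or_eq_neg.mp (h.trans (one_pow 2).symm) with h | h
  · left
    have z : (a.1 - b.1) ^ 2 + (a.2 - b.2) ^ 2 = 0 := by linarith
    refine Prod.ext ?_ ?_ <;> nlinarith [sq_nonneg (a.1 - b.1), sq_nonneg (a.2 - b.2)]
  · right
    have z : (a.1 + b.1) ^ 2 + (a.2 + b.2) ^ 2 = 0 := by linarith
    refine Prod.ext ?_ ?_ <;> simp only [Prod.fst_neg, Prod.snd_neg] <;>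
      nlinarith [sq_nonneg (a.1 + b.1), sq_nonneg (a.2 + b.2)]

/-- the statement about linear combinations -/
lemma sp_span (n : ℕ) (R : ℝ) (x : (ℝ × ℝ) × (Fin n → ℝ × ℝ)) (k : Fin n)
    (h : x.1 - x.2 k = x.2 k - Bpt n R k ∨ x.1 - x.2 k = -(x.2 k - Bpt n R k)) :
    (x.1 - x.2 k, (0 : Fin n → ℝ × ℝ)) ∈
        Submodule.span ℝ (Set.range (grad1 n x) ∪ Set.range (grad2 n R x)) := by
  have h1 : grad1 n x k ∈ Submodule.span ℝ (Set.range (grad1 n x) ∪ Set.range (grad2 n R x)) :=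
    Submodule.subset_span (Or.inl ⟨k, rfl⟩)
  have h2 : grad2 n R x k ∈ Submodule.span ℝ (Set.range (grad1 n x) ∪ Set.range (grad2 n R x)) :=
    Submodule.subset_span (Or.inr ⟨k, rfl⟩)
  rcases h with h | h
  · have : (x.1 - x.2 k, (0 : Fin n → ℝ × ℝ)) = (1 / 2 : ℝ) • (grad1 n x k + grad2 n R x k) := by
      unfold grad1 grad2
      rw [h]
      refine Prod.ext ?_ ?_
      · simp
      · funext j
        by_cases hj : j = k <;> simp [hj]
    rw [this]
    exact Submodule.smul_mem _ _ (Submodule.add_mem _ h1 h2)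
  · have : (x.1 - x.2 k, (0 : Fin n → ℝ × ℝ)) = (1 / 2 : ℝ) • (grad1 n x k - grad2 n R x k) := by
      unfold grad1 grad2
      rw [h]
      refine Prod.ext ?_ ?_
      · simp
      · funext j
        by_cases hj : j = k
        · subst hj
          simp only [Pi.zero_apply, Prod.smul_snd, Prod.snd_sub, Pi.smul_apply, Pi.sub_apply, if_true]
          module
        · simp [hj]
    rw [this]
    exact Submodule.smul_mem _ _ (Submodule.sub_mem _ h1 h2)

lemma sp_coeff (n : ℕ) (R : ℝ) (x : (ℝ × ℝ) × (Fin n → ℝ × ℝ)) (hx : x ∈ MSpace n R)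
    (h : (((0 : ℝ), (1 : ℝ)), (0 : Fin n → ℝ × ℝ)) ∈
        Submodule.span ℝ (Set.range (grad1 n x) ∪ Set.range (grad2 n R x))) :
    ∃ l : Fin n → ℝ, ∑ k, l k • (x.1 - x.2 k) = ((0 : ℝ), (1 : ℝ)) ∧
      ∀ k, l k ≠ 0 → (x.1 - x.2 k = x.2 k - Bpt n R k ∨ x.1 - x.2 k = -(x.2 k - Bpt n R k)) := by
  rw [Submodule.span_union, Submodule.mem_sup] at h
  obtain ⟨y, hy, z, hz, hyz⟩ := h
  rw [Submodule.mem_span_range_iff_exists_fun] at hy hz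
  obtain ⟨l, rfl⟩ := hy
  obtain ⟨m, rfl⟩ := hz
  have e1 := congrArg Prod.fst hyz
  have e2 := congrArg Prod.snd hyz
  simp only [Prod.fst_add, Prod.snd_add, Prod.fst_sum, Prod.snd_sum] at e1 e2
  refine ⟨fun k => 2 * l k, ?_, ?_⟩
  · rw [← e1]
    simp [grad1, grad2, mul_smul, smul_comm (2 : ℝ)]
  · intro k hk
    have hk : l k ≠ 0 := by
      intro h; apply hk; simp [h]
    have e := congrFun e2 k
    simp only [Pi.add_apply, Finset.sum_apply, grad1, grad2, Prod.smul_snd, Pi.smul_apply, smul_ite,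
      smul_zero, Finset.sum_ite_eq, Finset.mem_univ, if_true, Pi.zero_apply] at e
    have ha := sp_enorm _ (hx k).1
    have hb := sp_enorm _ (hx k).2
    generalize x.1 - x.2 k = a at *
    generalize x.2 k - Bpt n R k = b at *
    apply sp_par a b ha hb
    have f1 := congrArg Prod.fst e
    have f2 := congrArg Prod.snd e
    simp at f1 f2
    apply mul_left_cancel₀ hk
    linear_combination (-b.2 / 2) * f1 + (b.1 / 2) * f2

lemma sp_Bnorm (n : ℕ) (R : ℝ) (k : Fin n) : (Bpt n R k).1 ^ 2 + (Bpt n R k).2 ^ 2 = R ^ 2 := by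
  simp only [Bpt]
  linear_combination R ^ 2 * Real.sin_sq_add_cos_sq (2 * (k.val : ℝ) * Real.pi / n)

lemma sp_str (C J B : ℝ × ℝ) (ha : (C - J).1 ^ 2 + (C - J).2 ^ 2 = 1) (h : C - J = J - B) :
    (C.1 - B.1) ^ 2 + (C.2 - B.2) ^ 2 = 4 := by
  have h1 := congrArg Prod.fst h
  have h2 := congrArg Prod.snd h
  simp at h1 h2 ha
  have e1 : C.1 - B.1 = 2 * (C.1 - J.1) := by linarith
  have e2 : C.2 - B.2 = 2 * (C.2 - J.2) := by linarith
  rw [e1, e2]; linarith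

lemma sp_le (C J B : ℝ × ℝ) (ha : (C - J).1 ^ 2 + (C - J).2 ^ 2 = 1)
    (hb : (J - B).1 ^ 2 + (J - B).2 ^ 2 = 1) :
    (C.1 - B.1) ^ 2 + (C.2 - B.2) ^ 2 ≤ 4 := by
  simp at ha hb
  nlinarith [sq_nonneg ((C.1 - J.1) - (J.1 - B.1)), sq_nonneg ((C.2 - J.2) - (J.2 - B.2))]

lemma sp_fold (C J B : ℝ × ℝ) (h : C - J = -(J - B)) : C = B := by
  have : C - J = B - J := by rw [h]; abel
  exact sub_left_injective this

/-- Suppose `0 < R < 2`, `R ≠ R_n`, `x ∈ M_n(R)`. The gradient `w` of the height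
function (the vector with a `1` in the coordinate of the second coordinate of `C`
and `0` elsewhere) lies in the span of `∇f_1(x), …, ∇f_{2n}(x)` iff
(i) two adjacent arms are stretched out, or (ii) some arm is folded and parallel
to the y-axis, or (iii) some arm is stretched out with `a_k = b_k = (0, ±1)`. -/
theorem stmt10 (n : ℕ) (hn : 2 ≤ n) (R : ℝ) (hR0 : 0 < R) (hR2 : R < 2)
    (hRne : R ≠ Rcrit n)
    (x : (ℝ × ℝ) × (Fin n → ℝ × ℝ)) (hx : x ∈ MSpace n R) :
    ((((0 : ℝ), (1 : ℝ)), (0 : Fin n → ℝ × ℝ)) ∈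
        Submodule.span ℝ (Set.range (grad1 n x) ∪ Set.range (grad2 n R x))) ↔
      ((∃ k k' : Fin n, (k' : ℕ) = ((k : ℕ) + 1) % n ∧
          x.1 - x.2 k = x.2 k - Bpt n R k ∧
          x.1 - x.2 k' = x.2 k' - Bpt n R k') ∨
       (∃ k : Fin n, x.1 = Bpt n R k ∧ (x.2 k - Bpt n R k).1 = 0) ∨
       (∃ k : Fin n, x.1 - x.2 k = x.2 k - Bpt n R k ∧
          (x.1 - x.2 k = ((0 : ℝ), (1 : ℝ)) ∨ x.1 - x.2 k = ((0 : ℝ), (-1 : ℝ))))) := by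
  classical
  have hN : ∀ k, (x.1 - x.2 k).1 ^ 2 + (x.1 - x.2 k).2 ^ 2 = 1 := fun k => sp_enorm _ (hx k).1
  have hM : ∀ k, (x.2 k - Bpt n R k).1 ^ 2 + (x.2 k - Bpt n R k).2 ^ 2 = 1 :=
    fun k => sp_enorm _ (hx k).2
  have hle := fun k => sp_le _ _ _ (hN k) (hM k)
  constructor
  · intro h
    obtain ⟨l, hl, hal⟩ := sp_coeff n R x hx h
    have hex : ∃ k, l k ≠ 0 := by
      by_contra hc
      push Not at hc
      simp only [hc, zero_smul, Finset.sum_const_zero] at hl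
      have := congrArg Prod.snd hl
      simp at this
    obtain ⟨k, hk⟩ := hex
    by_cases hj : ∃ j, j ≠ k ∧ l j ≠ 0
    · obtain ⟨j, hjk, hj⟩ := hj
      rcases hal j hj with aj | aj <;> rcases hal k hk with ak | ak
      · left
        have dj := sp_str _ _ _ (hN j) aj
        have dk := sp_str _ _ _ (hN k) ak
        have bj := sp_Bnorm n R j
        have bk := sp_Bnorm n R k
        have hpos : 0 < x.1.1 ^ 2 + x.1.2 ^ 2 := by
          by_contra hc
          have z1 : x.1.1 = 0 := by nlinarith [sq_nonneg x.1.1, sq_nonneg x.1.2]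
          have z2 : x.1.2 = 0 := by nlinarith [sq_nonneg x.1.1, sq_nonneg x.1.2]
          rw [z1, z2] at dj
          nlinarith
        have hadj := sp_adj n hn x.1.1 x.1.2 hpos j k hjk ?_ ?_
        · rcases hadj with h | h
          · exact ⟨j, k, h, aj, ak⟩
          · exact ⟨k, j, h, ak, aj⟩
        · intro i
          have hi := hle i
          have bi := sp_Bnorm n R i
          simp only [Bpt] at hi bi dj bj
          apply le_of_mul_le_mul_left _ hR0
          linarith
        · simp only [Bpt] at dk bk dj bj
          apply mul_left_cancel₀ hR0.ne'
          linarith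
      · exfalso
        have hC := sp_fold _ _ _ ak
        have dj := sp_str _ _ _ (hN j) aj
        rw [hC] at dj hle
        exact hRne (sp_crit n hn R hR0 j k hle dj)
      · exfalso
        have hC := sp_fold _ _ _ aj
        have dk := sp_str _ _ _ (hN k) ak
        rw [hC] at dk hle
        exact hRne (sp_crit n hn R hR0 k j hle dk)
      · exact absurd (sp_B_inj n hn R hR0 j k
          ((sp_fold _ _ _ aj).symm.trans (sp_fold _ _ _ ak))) hjk
    · push Not at hj
      rw [Finset.sum_eq_single k (fun j _ h => by rw [hj j h, zero_smul]) (by simp)] at hl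
      have f1 := congrArg Prod.fst hl
      rw [Prod.smul_fst, smul_eq_mul] at f1
      have f1' : (x.1 - x.2 k).1 = 0 := (mul_eq_zero.mp f1).resolve_left hk
      right
      rcases hal k hk with ak | ak
      · right
        refine ⟨k, ak, ?_⟩
        have := hN k
        rw [f1'] at this
        have h2 : (x.1 - x.2 k).2 ^ 2 = 1 := by linarith
        rcases (sq_eq_sq_iff_eq_or_eq_neg.mp (h2.trans (one_pow 2).symm)) with h | h
        · left; exact Prod.ext f1' h
        · right; exact Prod.ext f1' h
      · left
        refine ⟨k, sp_fold _ _ _ ak, ?_⟩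
        rw [ak, Prod.fst_neg] at f1'
        exact neg_eq_zero.mp f1'
  · rintro (⟨k, k', hkk, ak, ak'⟩ | ⟨k, hC, hb⟩ | ⟨k, ak, h | h⟩)
    · have hne : k ≠ k' := by
        rintro rfl
        have := k.isLt
        by_cases h : k.val + 1 < n
        · rw [Nat.mod_eq_of_lt h] at hkk; omega
        · rw [show k.val + 1 = n by omega, Nat.mod_self] at hkk; omega
      have s1 := sp_span n R x k (Or.inl ak)
      have s2 := sp_span n R x k' (Or.inl ak')
      have hdet : (x.1 - x.2 k).1 * (x.1 - x.2 k').2 - (x.1 - x.2 k).2 * (x.1 - x.2 k').1 ≠ 0 := by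
        intro hd
        have b1 := sp_Bnorm n R k
        have b2 := sp_Bnorm n R k'
        have n1 := hN k
        have p1 := congrArg Prod.fst ak
        have p2 := congrArg Prod.snd ak
        have q1 := congrArg Prod.fst ak'
        have q2 := congrArg Prod.snd ak'
        rcases sp_par _ _ (hN k) (hN k') hd with h | h
        · have r1 := congrArg Prod.fst h
          have r2 := congrArg Prod.snd h
          simp at r1 r2 p1 p2 q1 q2
          apply hne
          apply sp_B_inj n hn R hR0
          apply Prod.ext <;> linarith
        · have r1 := congrArg Prod.fst h
          have r2 := congrArg Prod.snd h
          simp at r1 r2 p1 p2 q1 q2 n1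
          have e1 : (Bpt n R k').1 - (Bpt n R k).1 = 4 * (x.1.1 - (x.2 k).1) := by linarith
          have e2 : (Bpt n R k').2 - (Bpt n R k).2 = 4 * (x.1.2 - (x.2 k).2) := by linarith
          have e3 : ((Bpt n R k').1 - (Bpt n R k).1) ^ 2 + ((Bpt n R k').2 - (Bpt n R k).2) ^ 2 = 16 := by
            rw [e1, e2]; linarith
          nlinarith [sq_nonneg ((Bpt n R k').1 + (Bpt n R k).1), sq_nonneg ((Bpt n R k').2 + (Bpt n R k).2)]
      generalize x.1 - x.2 k = a at *
      generalize x.1 - x.2 k' = b at *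
      have : (((0 : ℝ), (1 : ℝ)), (0 : Fin n → ℝ × ℝ)) =
          (-b.1 / (a.1 * b.2 - a.2 * b.1)) • (a, (0 : Fin n → ℝ × ℝ))
          + (a.1 / (a.1 * b.2 - a.2 * b.1)) • (b, (0 : Fin n → ℝ × ℝ)) := by
        refine Prod.ext (Prod.ext ?_ ?_) ?_
        · simp; field_simp; ring
        · simp only [Prod.snd_add, Prod.fst_add, Prod.smul_fst, Prod.smul_snd, smul_eq_mul]
          rw [div_mul_eq_mul_div, div_mul_eq_mul_div, ← add_div, eq_div_iff hdet]; ring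
        · simp
      rw [this]
      exact Submodule.add_mem _ (Submodule.smul_mem _ _ s1) (Submodule.smul_mem _ _ s2)
    · have ak : x.1 - x.2 k = -(x.2 k - Bpt n R k) := by rw [hC]; abel
      have s1 := sp_span n R x k (Or.inr ak)
      have f1 : (x.1 - x.2 k).1 = 0 := by rw [ak, Prod.fst_neg, hb, neg_zero]
      have n1 := hN k
      generalize x.1 - x.2 k = a at *
      rw [f1] at n1
      have : (((0 : ℝ), (1 : ℝ)), (0 : Fin n → ℝ × ℝ)) = a.2 • (a, (0 : Fin n → ℝ × ℝ)) := by
        refine Prod.ext (Prod.ext ?_ ?_) ?_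
        · simp [f1]
        · simp; linarith
        · simp
      rw [this]
      exact Submodule.smul_mem _ _ s1
    · have s1 := sp_span n R x k (Or.inl ak)
      rwa [h] at s1
    · have s1 := sp_span n R x k (Or.inl ak)
      rw [h] at s1
      have := Submodule.neg_mem _ s1
      simpa using this
end
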